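/- Under Assumptions (G1) and (G2), the N-player graph game admits a Nash equilibrium α̂^N=(α̂^{1,N},…,α̂^{N,N})∈𝒜^N, and it is unique up to dℙ⊗dt-a.e. equality of each component. -/

import Mathlib

open MeasureTheory Set Filter

noncomputable section

/-- Inner product on `L²([0,T],ℝ)`. -/
def ip (T : ℝ) (f g : ℝ → ℝ) : ℝ := ∫ t in Icc (0:ℝ) T, f t * g t

/-- Integral operator induced by a kernel `G`. -/
def opK (T : ℝ) (G : ℝ → ℝ → ℝ) (f : ℝ → ℝ) : ℝ → ℝ :=
  fun t => ∫ s in Icc (0:ℝ) T, G t s * f s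

/-- Integral operator induced by the adjoint kernel `G*(t,s) = G(s,t)`. -/
def opKadj (T : ℝ) (G : ℝ → ℝ → ℝ) (f : ℝ → ℝ) : ℝ → ℝ :=
  fun t => ∫ s in Icc (0:ℝ) T, G s t * f s

/-- `G ∈ L²([0,T]²,ℝ)`. -/
def IsL2Kernel (T : ℝ) (G : ℝ → ℝ → ℝ) : Prop :=
  Measurable (Function.uncurry G) ∧
    Integrable (fun p : ℝ × ℝ => (G p.1 p.2) ^ 2)
      ((volume.restrict (Icc (0:ℝ) T)).prod (volume.restrict (Icc (0:ℝ) T)))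

/-- Volterra kernel in `𝒢`: square integrable on `[0,T]²` and vanishing for `s ≥ t`. -/
def IsVolterraKernel (T : ℝ) (G : ℝ → ℝ → ℝ) : Prop :=
  IsL2Kernel T G ∧ ∀ t s : ℝ, t ≤ s → G t s = 0

/-- Membership in `L²([0,T],ℝ)`. -/
def MemL2 (T : ℝ) (f : ℝ → ℝ) : Prop :=
  Measurable f ∧ Integrable (fun t => (f t) ^ 2) (volume.restrict (Icc (0:ℝ) T))

/-- Membership in `L²([0,T],ℝ^N)`. -/
def MemL2N (T : ℝ) {N : ℕ} (f : ℝ → Fin N → ℝ) : Prop :=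
  (∀ i, Measurable fun t => f t i) ∧
    Integrable (fun t => ∑ i, (f t i) ^ 2) (volume.restrict (Icc (0:ℝ) T))

variable {Ω : Type}

/-- Square-integrability of a process on `[0,T] × Ω`. -/
def SqInt (T : ℝ) [MeasurableSpace Ω] (P : Measure Ω) (α : ℝ → Ω → ℝ) : Prop :=
  Integrable (fun p : ℝ × Ω => (α p.1 p.2) ^ 2) ((volume.restrict (Icc (0:ℝ) T)).prod P)

/-- Admissible control: progressively measurable and square integrable on `[0,T] × Ω`. -/
def Admissible (T : ℝ) {mΩ : MeasurableSpace Ω} (F : Filtration ℝ mΩ) (P : Measure Ω)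
    (α : ℝ → Ω → ℝ) : Prop :=
  ProgMeasurable F α ∧ SqInt T P α

/-- Objective functional `J₀^{i,N}` of player `i` in the `N`-player game on a weighted
graph with interaction matrix `w`. -/
def Jgraph (T : ℝ) {mΩ : MeasurableSpace Ω} (P : Measure Ω) {N : ℕ}
    (Atil Btil Ctil : ℝ → ℝ → ℝ) (lam : ℝ) (w : Fin N → Fin N → ℝ)
    (b : Fin N → ℝ → Ω → ℝ) (bstar : ℝ → Ω → ℝ) (c : Fin N → Ω → ℝ)
    (i : Fin N) (α : Fin N → ℝ → Ω → ℝ) : ℝ :=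
  ∫ ω,
    (- ip T (fun t => α i t ω)
        (fun t => opK T Atil (fun s => α i s ω) t + lam * α i t ω)
      - (1 / (N:ℝ)) * ∑ j, w i j *
          ip T (fun t => α i t ω)
            (fun t => opK T Btil (fun s => α j s ω) t + opKadj T Btil (fun s => α j s ω) t)
      - (1 / (N:ℝ)^2) * ∑ j, ∑ k, w i j * w i k *
          ip T (fun t => α j t ω) (opK T Ctil (fun s => α k s ω))
      + ip T (fun t => b i t ω) (fun t => α i t ω)
      + (1 / (N:ℝ)) * ∑ j, w i j * ip T (fun t => bstar t ω) (fun t => α j t ω)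
      + c i ω) ∂P

/-- Nash equilibrium of the `N`-player graph game. -/
def IsNashGraph (T : ℝ) {mΩ : MeasurableSpace Ω} (F : Filtration ℝ mΩ) (P : Measure Ω) {N : ℕ}
    (Atil Btil Ctil : ℝ → ℝ → ℝ) (lam : ℝ) (w : Fin N → Fin N → ℝ)
    (b : Fin N → ℝ → Ω → ℝ) (bstar : ℝ → Ω → ℝ) (c : Fin N → Ω → ℝ)
    (α : Fin N → ℝ → Ω → ℝ) : Prop :=
  (∀ i, Admissible T F P (α i)) ∧
    ∀ (i : Fin N) (β : ℝ → Ω → ℝ), Admissible T F P β →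
      Jgraph T P Atil Btil Ctil lam w b bstar c i (Function.update α i β)
        ≤ Jgraph T P Atil Btil Ctil lam w b bstar c i α

/-- Assumption (G2): coercivity of `λI + 𝐀̃ + (1/N) w ⋅ 𝐁̃` on `L²([0,T],ℝ^N)`. -/
def CoercGraph (T : ℝ) {N : ℕ} (Atil Btil : ℝ → ℝ → ℝ) (lam : ℝ)
    (w : Fin N → Fin N → ℝ) (c₀ : ℝ) : Prop :=
  ∀ f : ℝ → Fin N → ℝ, MemL2N T f →
    c₀ * (∫ t in Icc (0:ℝ) T, ∑ i, (f t i) ^ 2) ≤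
      ∫ t in Icc (0:ℝ) T, ∑ i, f t i *
        (lam * f t i + opK T Atil (fun s => f s i) t
          + (1 / (N:ℝ)) * ∑ j, w i j * opK T Btil (fun s => f s j) t)

/-- Objective functional on an abstract Hilbert space. -/
def Jabs {L : Type*} [NormedAddCommGroup L] [InnerProductSpace ℝ L] {N : ℕ}
    (DA DB DC : L →L[ℝ] L →L[ℝ] ℝ) (lam : ℝ) (w : Fin N → Fin N → ℝ) (b : Fin N → L) (bs : L)
    (c : Fin N → ℝ) (i : Fin N) (a : Fin N → L) : ℝ :=
  - (DA (a i) (a i) + lam * inner ℝ (a i) (a i))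
   - (1 / (N:ℝ)) * ∑ j, w i j * (DB (a i) (a j) + DB (a j) (a i))
   - (1 / (N:ℝ)^2) * ∑ j, ∑ k, w i j * w i k * DC (a j) (a k)
   + inner ℝ (b i) (a i)
   + (1 / (N:ℝ)) * ∑ j, w i j * inner ℝ bs (a j) + c i

lemma Jabs_update {L : Type*} [NormedAddCommGroup L] [InnerProductSpace ℝ L] {N : ℕ}
    (DA DB DC : L →L[ℝ] L →L[ℝ] ℝ) (lam : ℝ) (w : Fin N → Fin N → ℝ) (hw : ∀ i, w i i = 0)
    (b : Fin N → L) (bs : L)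
    (c : Fin N → ℝ) (i : Fin N) (a : Fin N → L) (h : L) :
    Jabs DA DB DC lam w b bs c i (Function.update a i (a i + h)) =
      Jabs DA DB DC lam w b bs c i a + 
      (inner ℝ (b i) h - (2 * lam * inner ℝ (a i) h + DA (a i) h + DA h (a i)
        + (1 / (N:ℝ)) * ∑ j, w i j * (DB h (a j) + DB (a j) h)))
      - (lam * inner ℝ h h + DA h h) := by
  have key : ∀ (x : L) (f : L → ℝ) (j), w i j * f (Function.update a i x j) = w i j * f (a j) := by
    intro x f j
    by_cases hj : j = i
    · subst hj; simp [hw]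
    · rw [Function.update_of_ne hj]
  unfold Jabs
  have h1 : ∑ j, w i j * (DB (Function.update a i (a i + h) i) (Function.update a i (a i + h) j)
      + DB (Function.update a i (a i + h) j) (Function.update a i (a i + h) i)) =
      ∑ j, w i j * (DB (a i) (a j) + DB (a j) (a i)) + ∑ j, w i j * (DB h (a j) + DB (a j) h) := by
    rw [← Finset.sum_add_distrib]
    refine Finset.sum_congr rfl fun j _ => ?_
    rw [Function.update_self, key _ (fun y => DB (a i + h) y + DB y (a i + h)) j]
    simp; ring
  have h2 : ∑ j, ∑ k, w i j * w i k * DC (Function.update a i (a i + h) j)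
      (Function.update a i (a i + h) k) = ∑ j, ∑ k, w i j * w i k * DC (a j) (a k) := by
    refine Finset.sum_congr rfl fun j _ => Finset.sum_congr rfl fun k _ => ?_
    rw [mul_assoc, key _ (fun y => w i k * DC y (Function.update a i (a i + h) k)) j,
      key _ (fun y => DC (a j) y) k]
    ring
  have h3 : ∑ j, w i j * inner ℝ bs (Function.update a i (a i + h) j) =
      ∑ j, w i j * inner ℝ bs (a j) :=
    Finset.sum_congr rfl fun j _ => key _ (fun y => inner ℝ bs y) j
  rw [h1, h2, h3, Function.update_self]
  simp only [map_add, _root_.add_apply, inner_add_left, inner_add_right,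
    real_inner_comm (a i) h]
  ring

theorem abstract_game {L : Type*} [NormedAddCommGroup L] [InnerProductSpace ℝ L] 
    (K : Submodule ℝ L) [CompleteSpace K] {N : ℕ}
    (DA DB DC : L →L[ℝ] L →L[ℝ] ℝ) (lam : ℝ) (w : Fin N → Fin N → ℝ) (hw : ∀ i, w i i = 0)
    (hsymm : ∀ i j, w i j = w j i)
    (b : Fin N → L) (bs : L) (c : Fin N → ℝ) (c₀ : ℝ) (hc₀ : 0 < c₀)
    (hco : ∀ a : Fin N → L, c₀ * ∑ i, ‖a i‖ ^ 2 ≤ ∑ i, (lam * inner ℝ (a i) (a i) + DA (a i) (a i)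
       + (1 / (N:ℝ)) * ∑ j, w i j * DB (a i) (a j))) :
    ∃ a : Fin N → L, (∀ i, a i ∈ K) ∧
      (∀ i, ∀ x ∈ K, Jabs DA DB DC lam w b bs c i (Function.update a i x)
        ≤ Jabs DA DB DC lam w b bs c i a) ∧
      ∀ a' : Fin N → L, (∀ i, a' i ∈ K) →
      (∀ i, ∀ x ∈ K, Jabs DA DB DC lam w b bs c i (Function.update a' i x)
        ≤ Jabs DA DB DC lam w b bs c i a') → a = a' := by
  classical
  have hR : ∀ h : L, N ≠ 0 → c₀ * ‖h‖ ^ 2 ≤ lam * inner ℝ h h + DA h h := by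
    intro h hN
    obtain ⟨i⟩ : Nonempty (Fin N) := ⟨⟨0, Nat.pos_of_ne_zero hN⟩⟩
    have := hco (Function.update 0 i h)
    have e1 : ∑ j, ‖Function.update (0 : Fin N → L) i h j‖ ^ 2 = ‖h‖ ^ 2 := by
      rw [Finset.sum_eq_single i]
      · simp
      · intro j _ hj; simp [Function.update_of_ne hj]
      · simp
    rw [e1, Finset.sum_eq_single i] at this
    · rw [Finset.sum_eq_zero] at this
      · simpa using this
      · intro j _
        by_cases hj : j = i
        · subst hj; simp [hw]
        · simp [Function.update_of_ne hj]
    · intro j _ hj; simp [Function.update_of_ne hj]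
    · simp
  let H := PiLp 2 (fun _ : Fin N => K)
  let π : Fin N → (H →L[ℝ] L) := fun i => K.subtypeL ∘L (PiLp.proj 2 (fun _ : Fin N => K) i)
  have hπ : ∀ i (x : H), π i x = (x i : L) := fun i x => rfl
  let I : L →L[ℝ] L →L[ℝ] ℝ := innerSL ℝ
  have hI : ∀ x y, I x y = inner ℝ x y := fun x y => rfl
  let q : H →L[ℝ] H →L[ℝ] ℝ := ∑ i, ((2 * lam) • I.bilinearComp (π i) (π i)
     + DA.bilinearComp (π i) (π i) + DA.flip.bilinearComp (π i) (π i)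
     + (1 / (N:ℝ)) • ∑ j, w i j • (DB.flip.bilinearComp (π j) (π i) + DB.bilinearComp (π j) (π i)))
  have hq : ∀ x y : H, q x y = ∑ i, (2 * lam * inner ℝ (x i : L) (y i : L) + DA (x i) (y i)
      + DA (y i) (x i) + (1 / (N:ℝ)) * ∑ j, w i j * (DB (y i) (x j) + DB (x j) (y i))) := by
    intro x y
    simp only [mul_add]
    simp [q, hπ, hI]
  have hqq : ∀ x : H, q x x = 2 * ∑ i, (lam * inner ℝ (x i : L) (x i : L) + DA (x i) (x i)
       + (1 / (N:ℝ)) * ∑ j, w i j * DB (x i) (x j)) := by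
    intro x
    rw [hq]
    have : ∑ i, (1 / (N:ℝ)) * ∑ j, w i j * DB (x j : L) (x i) = 
        ∑ i, (1 / (N:ℝ)) * ∑ j, w i j * DB (x i : L) (x j) := by
      rw [← Finset.mul_sum, ← Finset.mul_sum, Finset.sum_comm]
      congr 1
      refine Finset.sum_congr rfl fun j _ => Finset.sum_congr rfl fun k _ => ?_
      rw [hsymm]
    simp only [mul_add, Finset.sum_add_distrib]
    rw [this]
    simp only [← Finset.mul_sum]
    ring
  have hn : ∀ x : H, ‖x‖ ^ 2 = ∑ i, ‖(x i : L)‖ ^ 2 := by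
    intro x
    rw [PiLp.norm_sq_eq_of_L2]; rfl
  have hcoer : IsCoercive q := by
    refine ⟨2 * c₀, by positivity, fun x => ?_⟩
    have := hco (fun i => x i)
    rw [hqq, mul_assoc, mul_assoc, ← sq, hn]
    linarith
  let ell : H →L[ℝ] ℝ := ∑ i, (innerSL ℝ (b i)) ∘L (π i)
  have hell : ∀ x : H, ell x = ∑ i, inner ℝ (b i) (x i : L) := by
    intro x; simp [ell, hπ]
  let v : H := (InnerProductSpace.toDual ℝ H).symm ell
  obtain ⟨z, hz⟩ : ∃ z : H, ∀ y, q z y = ell y := by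
    refine ⟨hcoer.continuousLinearEquivOfBilin.symm v, fun y => ?_⟩
    rw [← hcoer.continuousLinearEquivOfBilin_apply]
    simp [v]
  -- first variation
  have hsingle : ∀ (x : H) (i) (h : K), q x (WithLp.toLp 2 (Pi.single i h)) = 
     2 * lam * inner ℝ (x i : L) (h : L) + DA (x i) h
      + DA h (x i) + (1 / (N:ℝ)) * ∑ j, w i j * (DB h (x j) + DB (x j) h) := by
    intro x i h
    rw [hq, Finset.sum_eq_single i]
    · simp
    · intro j _ hj; simp [hj]
    · simp
  have hsingle' : ∀ (i) (h : K), ell (WithLp.toLp 2 (Pi.single i h)) = inner ℝ (b i) (h : L) := by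
    intro i h
    rw [hell, Finset.sum_eq_single i]
    · simp
    · intro j _ hj; simp [hj]
    · simp
  refine ⟨fun i => z i, fun i => (z i).2, ?_, ?_⟩
  · intro i x hx
    have hN : N ≠ 0 := by rintro rfl; exact i.elim0
    have := Jabs_update DA DB DC lam w hw b bs c i (fun i => z i) (x - z i)
    rw [add_sub_cancel] at this
    rw [this]
    have h1 := hsingle z i (⟨x, hx⟩ - z i)
    rw [hz, hsingle'] at h1
    have h2 := hR (x - z i) hN
    have h3 : 0 ≤ c₀ * ‖x - z i‖ ^ 2 := by positivity
    simp only [AddSubgroupClass.coe_sub] at h1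
    linarith
  · intro a' ha' hopt
    let z' : H := WithLp.toLp 2 (fun i => ⟨a' i, ha' i⟩)
    have hz' : ∀ i (h : K), q z' (WithLp.toLp 2 (Pi.single i h)) = 
        ell (WithLp.toLp 2 (Pi.single i h)) := by
      intro i h
      rw [hsingle, hsingle']
      have hall : ∀ ε : ℝ, ε * (inner ℝ (b i) (h:L) - (2 * lam * inner ℝ (a' i) (h:L) + DA (a' i) h + DA h (a' i)
        + (1 / (N:ℝ)) * ∑ j, w i j * (DB h (a' j) + DB (a' j) h))) - 
        ε ^ 2 * (lam * inner ℝ (h:L) (h:L) + DA h h) ≤ 0 := by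
        intro ε
        have h1 := hopt i (a' i + ε • (h:L)) (K.add_mem (ha' i) (K.smul_mem _ h.2))
        rw [Jabs_update DA DB DC lam w hw b bs c i a' (ε • (h:L))] at h1
        simp only [map_smul, _root_.smul_apply, inner_smul_left, inner_smul_right,
          smul_eq_mul, ← mul_add] at h1
        have e : ∑ j, w i j * (ε * (DB h (a' j) + DB (a' j) h)) =
            ε * ∑ j, w i j * (DB h (a' j) + DB (a' j) h) := by
          rw [Finset.mul_sum]; refine Finset.sum_congr rfl fun j _ => by ring
        rw [e] at h1
        simp at h1 ⊢
        linarith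
      set X := (inner ℝ (b i) (h:L) - (2 * lam * inner ℝ (a' i) (h:L) + DA (a' i) h + DA h (a' i)
        + (1 / (N:ℝ)) * ∑ j, w i j * (DB h (a' j) + DB (a' j) h))) with hX
      set R := (lam * inner ℝ (h:L) (h:L) + DA h h)
      have hX0 : X = 0 := by
        by_contra hne
        have hpos : 0 < X ^ 2 := by positivity
        have h1 := hall (X / (|R| + 1))
        have hd : 0 < |R| + 1 := by positivity
        have h2 : X / (|R| + 1) * X - (X / (|R| + 1)) ^ 2 * R = 
          X ^ 2 * (|R| + 1 - R) / (|R| + 1) ^ 2 := by field_simp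
        rw [h2] at h1
        have : 0 < X ^ 2 * (|R| + 1 - R) / (|R| + 1) ^ 2 := by
          have := le_abs_self R
          have : 0 < |R| + 1 - R := by linarith
          positivity
        linarith
      rw [hX] at hX0
      change 2 * lam * inner ℝ (a' i) (h:L) + DA (a' i) h + DA h (a' i)
        + (1 / (N:ℝ)) * ∑ j, w i j * (DB h (a' j) + DB (a' j) h) = _
      linarith
    have hzall : ∀ y : H, q z' y = ell y := by
      intro y
      have hy : y = ∑ i, WithLp.toLp 2 (Pi.single i (y i)) := by
        ext i
        simp [Finset.sum_apply, Pi.single_apply]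
      rw [hy, map_sum, map_sum]
      exact Finset.sum_congr rfl fun i _ => hz' i _
    have hzz : z = z' := by
      obtain ⟨C, hC, hC'⟩ := hcoer
      have h0 : q (z - z') (z - z') = 0 := by
        rw [map_sub q, _root_.sub_apply, hz, hzall, sub_self]
      have h1 := hC' (z - z')
      rw [h0, mul_assoc] at h1
      have h2 : ‖z - z'‖ = 0 := by
        by_contra hne
        have : 0 < C * (‖z - z'‖ * ‖z - z'‖) := by positivity
        linarith
      exact sub_eq_zero.mp (norm_eq_zero.mp h2)
    funext i
    rw [hzz]

/-- The progressive sigma-algebra -/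
@[reducible] def progSigma {mΩ : MeasurableSpace Ω} (F : Filtration ℝ mΩ) : MeasurableSpace (ℝ × Ω) :=
  ⨅ t : ℝ, MeasurableSpace.map (fun p : Iic t × Ω => ((p.1 : ℝ), p.2))
    (Subtype.instMeasurableSpace.prod (F t))

lemma progSigma_le {mΩ : MeasurableSpace Ω} (F : Filtration ℝ mΩ) :
    progSigma F ≤ Prod.instMeasurableSpace := by
  intro S hS
  have h1 : ∀ t : ℝ, MeasurableSet (Set.preimage (fun p : Iic t × Ω => ((p.1 : ℝ), p.2)) S) := by
    intro t
    have h2 : MeasurableSet[MeasurableSpace.map (fun p : Iic t × Ω => ((p.1 : ℝ), p.2))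
      (Subtype.instMeasurableSpace.prod (F t))] S := (iInf_le _ t : progSigma F ≤ _) S hS
    have h3 : Subtype.instMeasurableSpace.prod (F t) ≤
      (Subtype.instMeasurableSpace.prod mΩ : MeasurableSpace (Iic t × Ω)) :=
      sup_le_sup le_rfl (MeasurableSpace.comap_mono (F.le t))
    exact h3 _ h2
  have h2 : S = ⋃ n : ℕ, Set.image (fun p : Iic (n:ℝ) × Ω => ((p.1 : ℝ), p.2))
      (Set.preimage (fun p : Iic (n:ℝ) × Ω => ((p.1 : ℝ), p.2)) S) := by
    ext ⟨t, ω⟩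
    simp only [mem_iUnion, mem_image, mem_preimage, Prod.exists, Prod.mk.injEq]
    constructor
    · intro h
      obtain ⟨n, hn⟩ := exists_nat_ge t
      exact ⟨n, ⟨t, hn⟩, ω, h, rfl, rfl⟩
    · rintro ⟨n, t', ω', h, rfl, rfl⟩
      exact h
  rw [h2]
  refine MeasurableSet.iUnion fun n => ?_
  have hemb : MeasurableEmbedding (fun p : Iic (n:ℝ) × Ω => ((p.1 : ℝ), p.2)) :=
    (MeasurableEmbedding.subtype_coe measurableSet_Iic).prodMap MeasurableEmbedding.id
  exact hemb.measurableSet_image' (h1 n)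

lemma prog_iff {mΩ : MeasurableSpace Ω} (F : Filtration ℝ mΩ) (α : ℝ → Ω → ℝ) :
    ProgMeasurable F α ↔ StronglyMeasurable[progSigma F] (fun p : ℝ × Ω => α p.1 p.2) := by
  have : StronglyMeasurable[progSigma F] (fun p : ℝ × Ω => α p.1 p.2) ↔ 
      Measurable[progSigma F] (fun p : ℝ × Ω => α p.1 p.2) :=
    ⟨fun h => h.measurable, fun h => by exact h.stronglyMeasurable⟩
  rw [this]
  constructor
  · intro h S hS
    rw [progSigma, MeasurableSpace.measurableSet_iInf]
    intro t
    exact (h t).measurable hS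
  · intro h t
    refine @Measurable.stronglyMeasurable _ _ (_) _ _ _ _ _ _ ?_
    intro S hS
    have := h hS
    rw [progSigma, MeasurableSpace.measurableSet_iInf] at this
    exact this t


/-- Lebesgue measure on `[0,T]`. -/
abbrev mI (T : ℝ) : Measure ℝ := volume.restrict (Icc (0:ℝ) T)

lemma cs_int {X : Type*} {mX : MeasurableSpace X} {m : Measure X} {u v : X → ℝ}
    (hu : MemLp u 2 m) (hv : MemLp v 2 m) :
    |∫ x, u x * v x ∂m| ≤ √(∫ x, u x ^ 2 ∂m) * √(∫ x, v x ^ 2 ∂m) := by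
  have key : ∀ {f g : X → ℝ} (hf : MemLp f 2 m) (hg : MemLp g 2 m),
      inner ℝ (hf.toLp f) (hg.toLp g) = ∫ x, f x * g x ∂m := by
    intro f g hf hg
    rw [L2.inner_def]
    refine integral_congr_ae ?_
    filter_upwards [hf.coeFn_toLp, hg.coeFn_toLp] with x h1 h2
    rw [h1, h2]; simp [mul_comm]
  have hn : ∀ {f : X → ℝ} (hf : MemLp f 2 m), ‖hf.toLp f‖ = √(∫ x, f x ^ 2 ∂m) := by
    intro f hf
    rw [norm_eq_sqrt_real_inner, key hf hf]
    simp only [sq]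
  rw [← key hu hv, ← hn hu, ← hn hv]
  exact abs_real_inner_le_norm _ _

lemma inner_toLp {X : Type*} {mX : MeasurableSpace X} {m : Measure X} {f g : X → ℝ}
    (hf : MemLp f 2 m) (hg : MemLp g 2 m) :
      inner ℝ (hf.toLp f) (hg.toLp g) = ∫ x, f x * g x ∂m := by
  rw [L2.inner_def]
  refine integral_congr_ae ?_
  filter_upwards [hf.coeFn_toLp, hg.coeFn_toLp] with x h1 h2
  rw [h1, h2]; simp [mul_comm]

lemma tensor_memLp {T : ℝ} {f g : ℝ → ℝ} (hf : MemLp f 2 (mI T)) (hg : MemLp g 2 (mI T)) :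
    MemLp (fun p : ℝ × ℝ => f p.1 * g p.2) 2 ((mI T).prod (mI T)) := by
  rw [memLp_two_iff_integrable_sq]
  · simp only [mul_pow]
    exact Integrable.mul_prod hf.integrable_sq hg.integrable_sq
  · exact hf.1.comp_fst.mul hg.1.comp_snd

lemma kernel_memLp {T : ℝ} {G : ℝ → ℝ → ℝ} (hG : IsL2Kernel T G) :
    MemLp (fun p : ℝ × ℝ => G p.1 p.2) 2 ((mI T).prod (mI T)) := by
  rw [memLp_two_iff_integrable_sq]
  · exact hG.2
  · exact hG.1.aestronglyMeasurable

lemma tri_int {T : ℝ} {G : ℝ → ℝ → ℝ} (hG : IsL2Kernel T G) {f g : ℝ → ℝ}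
    (hf : MemLp f 2 (mI T)) (hg : MemLp g 2 (mI T)) :
    Integrable (fun p : ℝ × ℝ => G p.1 p.2 * (f p.1 * g p.2)) ((mI T).prod (mI T)) :=
  (kernel_memLp hG).integrable_mul (tensor_memLp hf hg)

/-- trilinear expression -/
def tri (T : ℝ) (G : ℝ → ℝ → ℝ) (f g : ℝ → ℝ) : ℝ :=
  ∫ p, G p.1 p.2 * (f p.1 * g p.2) ∂((mI T).prod (mI T))

lemma tri_bound {T : ℝ} {G : ℝ → ℝ → ℝ} (hG : IsL2Kernel T G) {f g : ℝ → ℝ}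
    (hf : MemLp f 2 (mI T)) (hg : MemLp g 2 (mI T)) :
    |tri T G f g| ≤ √(∫ p, G p.1 p.2 ^ 2 ∂((mI T).prod (mI T))) *
      (√(∫ t, f t ^ 2 ∂(mI T)) * √(∫ t, g t ^ 2 ∂(mI T))) := by
  refine (cs_int (kernel_memLp hG) (tensor_memLp hf hg)).trans_eq ?_
  congr 1
  rw [← Real.sqrt_mul (integral_nonneg fun t => sq_nonneg _)]
  congr 1
  simp only [mul_pow]
  rw [← integral_prod_mul]

lemma tri_congr {T : ℝ} {G : ℝ → ℝ → ℝ} {f g f' g' : ℝ → ℝ}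
    (hf : f =ᵐ[mI T] f') (hg : g =ᵐ[mI T] g') : tri T G f g = tri T G f' g' := by
  refine integral_congr_ae ?_
  have h1 := Measure.quasiMeasurePreserving_fst (μ := mI T) (ν := mI T) |>.ae hf
  have h2 := Measure.quasiMeasurePreserving_snd (μ := mI T) (ν := mI T) |>.ae hg
  filter_upwards [h1, h2] with p h1 h2
  rw [h1, h2]

lemma mul_opK_integrable {T : ℝ} {G : ℝ → ℝ → ℝ} (hG : IsL2Kernel T G) {f g : ℝ → ℝ}
    (hf : MemLp f 2 (mI T)) (hg : MemLp g 2 (mI T)) :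
    Integrable (fun t => f t * opK T G g t) (mI T) := by
  have := (tri_int hG hf hg).integral_prod_left
  refine this.congr (ae_of_all _ fun t => ?_)
  simp only [opK]
  rw [← integral_const_mul]
  congr 1; ext s; ring

lemma ip_opK {T : ℝ} {G : ℝ → ℝ → ℝ} (hG : IsL2Kernel T G) {f g : ℝ → ℝ}
    (hf : MemLp f 2 (mI T)) (hg : MemLp g 2 (mI T)) :
    ip T f (opK T G g) = tri T G f g := by
  rw [tri, integral_prod _ (tri_int hG hf hg), ip]
  congr 1; ext t
  rw [opK, ← integral_const_mul]
  congr 1; ext s; ring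

lemma mul_opKadj_integrable {T : ℝ} {G : ℝ → ℝ → ℝ} (hG : IsL2Kernel T G) {f g : ℝ → ℝ}
    (hf : MemLp f 2 (mI T)) (hg : MemLp g 2 (mI T)) :
    Integrable (fun t => f t * opKadj T G g t) (mI T) := by
  have := (tri_int hG hg hf).integral_prod_right
  refine this.congr (ae_of_all _ fun t => ?_)
  simp only [opKadj]
  rw [← integral_const_mul]
  congr 1; ext s; ring

lemma ip_opKadj {T : ℝ} {G : ℝ → ℝ → ℝ} (hG : IsL2Kernel T G) {f g : ℝ → ℝ}
    (hf : MemLp f 2 (mI T)) (hg : MemLp g 2 (mI T)) :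
    ip T f (opKadj T G g) = tri T G g f := by
  rw [tri, integral_prod_symm _ (tri_int hG hg hf), ip]
  congr 1; ext t
  rw [opKadj, ← integral_const_mul]
  congr 1; ext s; ring

section proc
variable {mΩ : MeasurableSpace Ω} {P : Measure Ω} [IsProbabilityMeasure P] {T : ℝ}

lemma section_memLp {a : ℝ × Ω → ℝ} (hm : Measurable a) (ha : MemLp a 2 ((mI T).prod P)) :
    ∀ᵐ ω ∂P, MemLp (fun t => a (t, ω)) 2 (mI T) := by
  filter_upwards [ha.integrable_sq.prod_left_ae] with ω hω
  rw [memLp_two_iff_integrable_sq]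
  · exact hω
  · exact (hm.comp measurable_prodMk_right).aestronglyMeasurable

lemma section_congr {a a' : ℝ × Ω → ℝ} (h : a =ᵐ[(mI T).prod P] a') :
    ∀ᵐ ω ∂P, (fun t => a (t, ω)) =ᵐ[mI T] (fun t => a' (t, ω)) := by
  have h1 := (Measure.measurePreserving_swap (μ := P) (ν := mI T)).quasiMeasurePreserving.ae h
  exact Measure.ae_ae_of_ae_prod h1

lemma tri_meas {G : ℝ → ℝ → ℝ} (hG : IsL2Kernel T G) {a b : ℝ × Ω → ℝ}
    (ha : Measurable a) (hb : Measurable b) :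
    StronglyMeasurable (fun ω => tri T G (fun t => a (t, ω)) (fun t => b (t, ω))) := by
  have : Measurable (fun q : Ω × (ℝ × ℝ) =>
      G q.2.1 q.2.2 * (a (q.2.1, q.1) * b (q.2.2, q.1))) := by
    have h1 : Measurable (fun q : Ω × (ℝ × ℝ) => G q.2.1 q.2.2) := hG.1.comp measurable_snd
    have h2 : Measurable (fun q : Ω × (ℝ × ℝ) => a (q.2.1, q.1)) := ha.comp (by fun_prop)
    have h3 : Measurable (fun q : Ω × (ℝ × ℝ) => b (q.2.2, q.1)) := hb.comp (by fun_prop)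
    exact h1.mul (h2.mul h3)
  exact this.stronglyMeasurable.integral_prod_right'

lemma sqrt_section_memLp {a : ℝ × Ω → ℝ} (hm : Measurable a) (ha : MemLp a 2 ((mI T).prod P)) :
    MemLp (fun ω => √(∫ t, a (t, ω) ^ 2 ∂(mI T))) 2 P := by
  rw [memLp_two_iff_integrable_sq]
  · refine ha.integrable_sq.integral_prod_right.congr (ae_of_all _ fun ω => ?_)
    exact (Real.sq_sqrt (integral_nonneg fun t => sq_nonneg _)).symm
  · have := ha.integrable_sq.integral_prod_right.1
    exact Real.continuous_sqrt.comp_aestronglyMeasurable this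

lemma sqrt_section_int {a : ℝ × Ω → ℝ} (ha : MemLp a 2 ((mI T).prod P)) :
    ∫ ω, √(∫ t, a (t, ω) ^ 2 ∂(mI T)) ^ 2 ∂P = ∫ p, a p ^ 2 ∂((mI T).prod P) := by
  rw [integral_prod_symm _ ha.integrable_sq]
  congr 1; ext ω
  exact Real.sq_sqrt (integral_nonneg fun t => sq_nonneg _)

lemma tri_proc_integrable {G : ℝ → ℝ → ℝ} (hG : IsL2Kernel T G) {a b : ℝ × Ω → ℝ}
    (ham : Measurable a) (hbm : Measurable b) (ha : MemLp a 2 ((mI T).prod P))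
    (hb : MemLp b 2 ((mI T).prod P)) :
    Integrable (fun ω => tri T G (fun t => a (t, ω)) (fun t => b (t, ω))) P := by
  have h := ((sqrt_section_memLp ham ha).integrable_mul (sqrt_section_memLp hbm hb)).const_mul
    √(∫ p, G p.1 p.2 ^ 2 ∂((mI T).prod (mI T)))
  refine h.mono' (tri_meas hG ham hbm).aestronglyMeasurable ?_
  filter_upwards [section_memLp ham ha, section_memLp hbm hb] with ω h1 h2
  exact tri_bound hG h1 h2

lemma tri_proc_bound {G : ℝ → ℝ → ℝ} (hG : IsL2Kernel T G) {a b : ℝ × Ω → ℝ}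
    (ham : Measurable a) (hbm : Measurable b) (ha : MemLp a 2 ((mI T).prod P))
    (hb : MemLp b 2 ((mI T).prod P)) :
    |∫ ω, tri T G (fun t => a (t, ω)) (fun t => b (t, ω)) ∂P| ≤
     √(∫ p, G p.1 p.2 ^ 2 ∂((mI T).prod (mI T))) *
      (√(∫ p, a p ^ 2 ∂((mI T).prod P)) * √(∫ p, b p ^ 2 ∂((mI T).prod P))) := by
  have h := ((sqrt_section_memLp ham ha).integrable_mul (sqrt_section_memLp hbm hb)).const_mul
    √(∫ p, G p.1 p.2 ^ 2 ∂((mI T).prod (mI T)))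
  have h1 : |∫ ω, tri T G (fun t => a (t, ω)) (fun t => b (t, ω)) ∂P| ≤ _ :=
    norm_integral_le_of_norm_le
     (f := fun ω => tri T G (fun t => a (t, ω)) (fun t => b (t, ω))) h (by
      filter_upwards [section_memLp ham ha, section_memLp hbm hb] with ω h1 h2
      exact tri_bound hG h1 h2)
  refine h1.trans ?_
  rw [integral_const_mul]
  refine mul_le_mul_of_nonneg_left ?_ (Real.sqrt_nonneg _)
  have h2 := cs_int (sqrt_section_memLp ham ha) (sqrt_section_memLp hbm hb)
  rw [sqrt_section_int ha, sqrt_section_int hb] at h2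
  exact (le_abs_self _).trans h2

lemma tri_proc_congr {G : ℝ → ℝ → ℝ} {a b a' b' : ℝ × Ω → ℝ}
    (ha : a =ᵐ[(mI T).prod P] a') (hb : b =ᵐ[(mI T).prod P] b') :
    ∫ ω, tri T G (fun t => a (t, ω)) (fun t => b (t, ω)) ∂P =
    ∫ ω, tri T G (fun t => a' (t, ω)) (fun t => b' (t, ω)) ∂P := by
  refine integral_congr_ae ?_
  filter_upwards [section_congr ha, section_congr hb] with ω h1 h2
  exact tri_congr h1 h2

lemma tri_proc_add_left {G : ℝ → ℝ → ℝ} (hG : IsL2Kernel T G) {a a' b : ℝ × Ω → ℝ}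
    (ham : Measurable a) (ham' : Measurable a') (hbm : Measurable b)
    (ha : MemLp a 2 ((mI T).prod P)) (ha' : MemLp a' 2 ((mI T).prod P))
    (hb : MemLp b 2 ((mI T).prod P)) :
    ∫ ω, tri T G (fun t => (a + a') (t, ω)) (fun t => b (t, ω)) ∂P =
    ∫ ω, tri T G (fun t => a (t, ω)) (fun t => b (t, ω)) ∂P +
    ∫ ω, tri T G (fun t => a' (t, ω)) (fun t => b (t, ω)) ∂P := by
  rw [← integral_add (tri_proc_integrable hG ham hbm ha hb)
    (tri_proc_integrable hG ham' hbm ha' hb)]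
  refine integral_congr_ae ?_
  filter_upwards [section_memLp ham ha, section_memLp ham' ha', section_memLp hbm hb]
    with ω h1 h2 h3
  simp only [tri]
  rw [← integral_add (tri_int hG h1 h3) (tri_int hG h2 h3)]
  congr 1; ext p; simp only [Pi.add_apply]; ring

lemma tri_proc_add_right {G : ℝ → ℝ → ℝ} (hG : IsL2Kernel T G) {a b b' : ℝ × Ω → ℝ}
    (ham : Measurable a) (hbm : Measurable b) (hbm' : Measurable b')
    (ha : MemLp a 2 ((mI T).prod P)) (hb : MemLp b 2 ((mI T).prod P))
    (hb' : MemLp b' 2 ((mI T).prod P)) :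
    ∫ ω, tri T G (fun t => a (t, ω)) (fun t => (b + b') (t, ω)) ∂P =
    ∫ ω, tri T G (fun t => a (t, ω)) (fun t => b (t, ω)) ∂P +
    ∫ ω, tri T G (fun t => a (t, ω)) (fun t => b' (t, ω)) ∂P := by
  rw [← integral_add (tri_proc_integrable hG ham hbm ha hb)
    (tri_proc_integrable hG ham hbm' ha hb')]
  refine integral_congr_ae ?_
  filter_upwards [section_memLp ham ha, section_memLp hbm hb, section_memLp hbm' hb']
    with ω h1 h2 h3
  simp only [tri]
  rw [← integral_add (tri_int hG h1 h2) (tri_int hG h1 h3)]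
  congr 1; ext p; simp only [Pi.add_apply]; ring

variable (P) in
/-- The bilinear form `(α, β) ↦ 𝔼⟨α, 𝐆 β⟩` on `L²([0,T] × Ω)`. -/
def DK {G : ℝ → ℝ → ℝ} (hG : IsL2Kernel T G) :
    Lp ℝ 2 ((mI T).prod P) →L[ℝ] Lp ℝ 2 ((mI T).prod P) →L[ℝ] ℝ :=
  LinearMap.mkContinuous₂ (LinearMap.mk₂ ℝ
    (fun a b : Lp ℝ 2 ((mI T).prod P) =>
      ∫ ω, tri T G (fun t => a (t, ω)) (fun t => b (t, ω)) ∂P)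
    (by
      intro a a' b
      rw [← tri_proc_add_left hG (Lp.stronglyMeasurable a).measurable
        (Lp.stronglyMeasurable a').measurable (Lp.stronglyMeasurable b).measurable
        (Lp.memLp a) (Lp.memLp a') (Lp.memLp b)]
      exact tri_proc_congr (Lp.coeFn_add a a') (ae_eq_refl _))
    (by
      intro r a b
      rw [tri_proc_congr (Lp.coeFn_smul r a) (ae_eq_refl _), smul_eq_mul, ← integral_const_mul]
      congr 1; ext ω
      rw [tri, tri, ← integral_const_mul]
      congr 1; ext p; simp only [Pi.smul_apply, smul_eq_mul]; ring)
    (by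
      intro a b b'
      rw [← tri_proc_add_right hG (Lp.stronglyMeasurable a).measurable
        (Lp.stronglyMeasurable b).measurable (Lp.stronglyMeasurable b').measurable
        (Lp.memLp a) (Lp.memLp b) (Lp.memLp b')]
      exact tri_proc_congr (ae_eq_refl _) (Lp.coeFn_add b b'))
    (by
      intro r a b
      rw [tri_proc_congr (ae_eq_refl _) (Lp.coeFn_smul r b), smul_eq_mul, ← integral_const_mul]
      congr 1; ext ω
      rw [tri, tri, ← integral_const_mul]
      congr 1; ext p; simp only [Pi.smul_apply, smul_eq_mul]; ring))
    √(∫ p, G p.1 p.2 ^ 2 ∂((mI T).prod (mI T)))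
    (by
      intro a b
      have hn : ∀ f : Lp ℝ 2 ((mI T).prod P), ‖f‖ = √(∫ x, f x ^ 2 ∂((mI T).prod P)) := by
        intro f
        rw [norm_eq_sqrt_real_inner, L2.inner_def]
        simp [sq]
      rw [hn, hn, mul_assoc]
      exact tri_proc_bound hG (Lp.stronglyMeasurable a).measurable
        (Lp.stronglyMeasurable b).measurable (Lp.memLp a) (Lp.memLp b))

lemma DK_toLp {G : ℝ → ℝ → ℝ} (hG : IsL2Kernel T G) {a b : ℝ × Ω → ℝ}
    (ha : MemLp a 2 ((mI T).prod P)) (hb : MemLp b 2 ((mI T).prod P)) :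
    DK P hG (ha.toLp a) (hb.toLp b) =
      ∫ ω, tri T G (fun t => a (t, ω)) (fun t => b (t, ω)) ∂P :=
  tri_proc_congr ha.coeFn_toLp hb.coeFn_toLp

lemma DK_apply {G : ℝ → ℝ → ℝ} (hG : IsL2Kernel T G) (a b : Lp ℝ 2 ((mI T).prod P)) :
    DK P hG a b = ∫ ω, tri T G (fun t => a (t, ω)) (fun t => b (t, ω)) ∂P := rfl

end proc

section hi
variable {mΩ : MeasurableSpace Ω} {P : Measure Ω}

/-- `f` is integrable with integral `x`. -/
def HI (P : Measure Ω) (f : Ω → ℝ) (x : ℝ) : Prop := Integrable f P ∧ ∫ ω, f ω ∂P = x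

lemma HI.add {f g : Ω → ℝ} {x y : ℝ} (hf : HI P f x) (hg : HI P g y) :
    HI P (fun ω => f ω + g ω) (x + y) :=
  ⟨hf.1.add hg.1, by rw [integral_add hf.1 hg.1, hf.2, hg.2]⟩

lemma HI.sub {f g : Ω → ℝ} {x y : ℝ} (hf : HI P f x) (hg : HI P g y) :
    HI P (fun ω => f ω - g ω) (x - y) :=
  ⟨hf.1.sub hg.1, by rw [integral_sub hf.1 hg.1, hf.2, hg.2]⟩

lemma HI.neg {f : Ω → ℝ} {x : ℝ} (hf : HI P f x) : HI P (fun ω => - f ω) (- x) :=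
  ⟨hf.1.neg, by rw [integral_neg, hf.2]⟩

lemma HI.const_mul {f : Ω → ℝ} {x : ℝ} (c : ℝ) (hf : HI P f x) :
    HI P (fun ω => c * f ω) (c * x) :=
  ⟨hf.1.const_mul c, by rw [integral_const_mul, hf.2]⟩

lemma HI.sum {ι : Type*} [Fintype ι] {f : ι → Ω → ℝ} {x : ι → ℝ} (hf : ∀ i, HI P (f i) (x i)) :
    HI P (fun ω => ∑ i, f i ω) (∑ i, x i) :=
  ⟨integrable_finsetSum _ fun i _ => (hf i).1, by
    rw [integral_finsetSum _ fun i _ => (hf i).1]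
    exact Finset.sum_congr rfl fun i _ => (hf i).2⟩

lemma HI.congr {f g : Ω → ℝ} {x : ℝ} (hf : HI P f x) (h : f =ᵐ[P] g) : HI P g x :=
  ⟨hf.1.congr h, by rw [← integral_congr_ae h, hf.2]⟩

variable [IsProbabilityMeasure P] {T : ℝ}

lemma HI_tri {G : ℝ → ℝ → ℝ} (hG : IsL2Kernel T G) {a b : ℝ × Ω → ℝ}
    (ham : Measurable a) (hbm : Measurable b) (ha : MemLp a 2 ((mI T).prod P))
    (hb : MemLp b 2 ((mI T).prod P)) :
    HI P (fun ω => tri T G (fun t => a (t, ω)) (fun t => b (t, ω)))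
      (DK P hG (ha.toLp a) (hb.toLp b)) :=
  ⟨tri_proc_integrable hG ham hbm ha hb, (DK_toLp hG ha hb).symm⟩

lemma HI_ip {a b : ℝ × Ω → ℝ}
    (ha : MemLp a 2 ((mI T).prod P)) (hb : MemLp b 2 ((mI T).prod P)) :
    HI P (fun ω => ip T (fun t => a (t, ω)) (fun t => b (t, ω)))
      (inner ℝ (ha.toLp a) (hb.toLp b)) := by
  have h : Integrable (fun p => a p * b p) ((mI T).prod P) := ha.integrable_mul hb
  refine ⟨h.integral_prod_right, ?_⟩
  rw [inner_toLp, integral_prod_symm _ h]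
  rfl

lemma coerc_abs {N : ℕ} {Atil Btil : ℝ → ℝ → ℝ} (hA : IsL2Kernel T Atil) (hB : IsL2Kernel T Btil)
    {lam : ℝ} {w : Fin N → Fin N → ℝ} {c₀ : ℝ} (hco : CoercGraph T Atil Btil lam w c₀)
    (a : Fin N → Lp ℝ 2 ((mI T).prod P)) :
    c₀ * ∑ i, ‖a i‖ ^ 2 ≤ ∑ i, (lam * inner ℝ (a i) (a i) + DK P hA (a i) (a i)
       + (1 / (N:ℝ)) * ∑ j, w i j * DK P hB (a i) (a j)) := by
  have ham : ∀ i, Measurable (a i) := fun i => (Lp.stronglyMeasurable (a i)).measurable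
  have haL : ∀ i, MemLp (a i) 2 ((mI T).prod P) := fun i => Lp.memLp (a i)
  have hto : ∀ i, (haL i).toLp (a i) = a i := fun i => Lp.toLp_coeFn _ _
  have hip : ∀ i, HI P (fun ω => ip T (fun t => a i (t, ω)) (fun t => a i (t, ω)))
      (inner ℝ (a i) (a i)) := fun i => by
    have := HI_ip (haL i) (haL i); rwa [hto] at this
  have htA : ∀ i j, HI P (fun ω => tri T Atil (fun t => a i (t, ω)) (fun t => a j (t, ω)))
      (DK P hA (a i) (a j)) := fun i j => by
    have := HI_tri hA (ham i) (ham j) (haL i) (haL j); rwa [hto, hto] at this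
  have htB : ∀ i j, HI P (fun ω => tri T Btil (fun t => a i (t, ω)) (fun t => a j (t, ω)))
      (DK P hB (a i) (a j)) := fun i j => by
    have := HI_tri hB (ham i) (ham j) (haL i) (haL j); rwa [hto, hto] at this
  have h1 := (HI.sum hip).const_mul c₀
  have h2 := HI.sum fun i => (((hip i).const_mul lam).add (htA i i)).add
    ((HI.sum fun j => (htB i j).const_mul (w i j)).const_mul (1 / (N:ℝ)))
  simp only [← real_inner_self_eq_norm_sq]
  rw [← h1.2, ← h2.2]
  refine integral_mono_ae h1.1 h2.1 ?_
  have hsec : ∀ᵐ ω ∂P, ∀ i, MemLp (fun t => a i (t, ω)) 2 (mI T) :=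
    ae_all_iff.2 fun i => section_memLp (ham i) (haL i)
  filter_upwards [hsec] with ω hω
  have h := hco (fun t i => a i (t, ω)) ⟨fun i => (ham i).comp measurable_prodMk_right,
    integrable_finsetSum _ fun i _ => (hω i).integrable_sq⟩
  have hff : ∀ i, Integrable (fun t => a i (t, ω) * a i (t, ω)) (mI T) :=
    fun i => (hω i).integrable_mul (hω i)
  have e1 : ∫ t in Icc (0:ℝ) T, ∑ i, (a i (t, ω)) ^ 2 =
      ∑ i, ip T (fun t => a i (t, ω)) (fun t => a i (t, ω)) := by
    rw [integral_finsetSum _ fun i _ => (hω i).integrable_sq]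
    simp only [ip, sq]
  have e2 : ∀ i, HI (mI T) (fun t => a i (t, ω) * (lam * a i (t, ω) +
      opK T Atil (fun s => a i (s, ω)) t
          + (1 / (N:ℝ)) * ∑ j, w i j * opK T Btil (fun s => a j (s, ω)) t))
      (lam * ip T (fun t => a i (t, ω)) (fun t => a i (t, ω)) +
        tri T Atil (fun t => a i (t, ω)) (fun t => a i (t, ω)) +
        (1 / (N:ℝ)) * ∑ j, w i j * tri T Btil (fun t => a i (t, ω)) (fun t => a j (t, ω))) := by
    intro i
    have k1 : HI (mI T) (fun t => a i (t, ω) * a i (t, ω))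
      (ip T (fun t => a i (t, ω)) (fun t => a i (t, ω))) := ⟨hff i, rfl⟩
    have k2 : HI (mI T) (fun t => a i (t, ω) * opK T Atil (fun s => a i (s, ω)) t)
      (tri T Atil (fun t => a i (t, ω)) (fun t => a i (t, ω))) :=
      ⟨mul_opK_integrable hA (hω i) (hω i), ip_opK hA (hω i) (hω i)⟩
    have k3 : ∀ j, HI (mI T) (fun t => a i (t, ω) * opK T Btil (fun s => a j (s, ω)) t)
      (tri T Btil (fun t => a i (t, ω)) (fun t => a j (t, ω))) := fun j =>
      ⟨mul_opK_integrable hB (hω i) (hω j), ip_opK hB (hω i) (hω j)⟩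
    refine (((k1.const_mul lam).add k2).add ((HI.sum fun j => (k3 j).const_mul (w i j)).const_mul
      (1 / (N:ℝ)))).congr (ae_of_all _ fun t => ?_)
    have : ∑ j, w i j * (a i (t, ω) * opK T Btil (fun s => a j (s, ω)) t) =
        a i (t, ω) * ∑ j, w i j * opK T Btil (fun s => a j (s, ω)) t := by
      rw [Finset.mul_sum]; exact Finset.sum_congr rfl fun j _ => by ring
    simp only [this]
    ring
  have e3 := (HI.sum e2).2
  rw [e1] at h
  exact h.trans_eq e3

lemma Jgraph_eq {N : ℕ} {Atil Btil Ctil : ℝ → ℝ → ℝ} (hA : IsL2Kernel T Atil)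
    (hB : IsL2Kernel T Btil) (hC : IsL2Kernel T Ctil) (lam : ℝ) (w : Fin N → Fin N → ℝ)
    (b : Fin N → ℝ → Ω → ℝ) (bstar : ℝ → Ω → ℝ) (c : Fin N → Ω → ℝ)
    (hb : ∀ i, MemLp (fun p : ℝ × Ω => b i p.1 p.2) 2 ((mI T).prod P))
    (hbs : MemLp (fun p : ℝ × Ω => bstar p.1 p.2) 2 ((mI T).prod P))
    (hc : ∀ i, Integrable (c i) P)
    (α : Fin N → ℝ → Ω → ℝ) (hαm : ∀ i, Measurable (fun p : ℝ × Ω => α i p.1 p.2))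
    (hα : ∀ i, MemLp (fun p : ℝ × Ω => α i p.1 p.2) 2 ((mI T).prod P)) (i : Fin N) :
    Jgraph T P Atil Btil Ctil lam w b bstar c i α =
      Jabs (DK P hA) (DK P hB) (DK P hC) lam w (fun i => (hb i).toLp _) (hbs.toLp _)
        (fun i => ∫ ω, c i ω ∂P) i (fun i => (hα i).toLp _) := by
  have t1 := ((HI_tri hA (hαm i) (hαm i) (hα i) (hα i)).add
    ((HI_ip (hα i) (hα i)).const_mul lam)).neg
  have t2 := (HI.sum fun j => ((HI_tri hB (hαm i) (hαm j) (hα i) (hα j)).add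
    (HI_tri hB (hαm j) (hαm i) (hα j) (hα i))).const_mul (w i j)).const_mul (1 / (N:ℝ))
  have t3 := (HI.sum fun j => HI.sum fun k =>
    (HI_tri hC (hαm j) (hαm k) (hα j) (hα k)).const_mul (w i j * w i k)).const_mul (1 / (N:ℝ)^2)
  have t4 := HI_ip (hb i) (hα i)
  have t5 := (HI.sum fun j => (HI_ip hbs (hα j)).const_mul (w i j)).const_mul (1 / (N:ℝ))
  have t6 : HI P (c i) (∫ ω, c i ω ∂P) := ⟨hc i, rfl⟩
  have key := ((((t1.sub t2).sub t3).add t4).add t5).add t6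
  refine (key.congr ?_).2
  have hsec : ∀ᵐ ω ∂P, ∀ i, MemLp (fun t => α i t ω) 2 (mI T) :=
    ae_all_iff.2 fun i => section_memLp (hαm i) (hα i)
  filter_upwards [hsec] with ω hω
  have s1 : ip T (fun t => α i t ω)
      (fun t => opK T Atil (fun s => α i s ω) t + lam * α i t ω) =
      tri T Atil (fun t => α i t ω) (fun t => α i t ω) +
      lam * ip T (fun t => α i t ω) (fun t => α i t ω) := by
    rw [← ip_opK hA (hω i) (hω i)]
    simp only [ip]
    have hsq : Integrable (fun t => lam * (α i t ω * α i t ω)) (mI T) :=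
      ((hω i).integrable_mul (hω i)).const_mul lam
    rw [← integral_const_mul, ← integral_add (mul_opK_integrable hA (hω i) (hω i)) hsq]
    congr 1; ext t; ring
  have s2 : ∀ j, ip T (fun t => α i t ω)
      (fun t => opK T Btil (fun s => α j s ω) t + opKadj T Btil (fun s => α j s ω) t) =
      tri T Btil (fun t => α i t ω) (fun t => α j t ω) +
      tri T Btil (fun t => α j t ω) (fun t => α i t ω) := by
    intro j
    rw [← ip_opK hB (hω i) (hω j), ← ip_opKadj hB (hω i) (hω j)]
    simp only [ip]
    rw [← integral_add (mul_opK_integrable hB (hω i) (hω j))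
      (mul_opKadj_integrable hB (hω i) (hω j))]
    congr 1; ext t; ring
  have s3 : ∀ j k, ip T (fun t => α j t ω) (opK T Ctil (fun s => α k s ω)) =
      tri T Ctil (fun t => α j t ω) (fun t => α k t ω) :=
    fun j k => ip_opK hC (hω j) (hω k)
  simp only [s1, s2, s3]

end hi

/-- Under Assumptions (G1) and (G2), the `N`-player graph game admits a
Nash equilibrium, unique up to `dℙ⊗dt`-a.e. equality of each component. -/
theorem graph_game_nash_exists_unique
    {Ω : Type} {mΩ : MeasurableSpace Ω} (P : Measure Ω) [IsProbabilityMeasure P]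
    (F : Filtration ℝ mΩ) (T : ℝ) (hT : 0 < T) (N : ℕ) (hN : 0 < N)
    (Atil Btil Ctil : ℝ → ℝ → ℝ)
    (hA : IsVolterraKernel T Atil) (hBk : IsVolterraKernel T Btil)
    (hCk : IsVolterraKernel T Ctil)
    (lam : ℝ) (hlam : 0 < lam)
    (w : Fin N → Fin N → ℝ) (hw01 : ∀ i j, w i j ∈ Icc (0:ℝ) 1)
    (hwsymm : ∀ i j, w i j = w j i) (hwdiag : ∀ i, w i i = 0)
    (b : Fin N → ℝ → Ω → ℝ) (hb : ∀ i, ProgMeasurable F (b i) ∧ SqInt T P (b i))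
    (bstar : ℝ → Ω → ℝ) (hbstar : ProgMeasurable F bstar ∧ SqInt T P bstar)
    (c : Fin N → Ω → ℝ) (hc : ∀ i, Integrable (c i) P ∧ Measurable[F T] (c i))
    (c₀ : ℝ) (hc₀ : 0 < c₀) (hcoerc : CoercGraph T Atil Btil lam w c₀) :
    ∃ αhat : Fin N → ℝ → Ω → ℝ,
      IsNashGraph T F P Atil Btil Ctil lam w b bstar c αhat ∧
        ∀ βhat : Fin N → ℝ → Ω → ℝ,
          IsNashGraph T F P Atil Btil Ctil lam w b bstar c βhat →
          ∀ i, ∀ᵐ p ∂((volume.restrict (Icc (0:ℝ) T)).prod P),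
            αhat i p.1 p.2 = βhat i p.1 p.2 := by
  classical
  have hmeas : ∀ {α : ℝ → Ω → ℝ}, ProgMeasurable F α →
      Measurable (fun p : ℝ × Ω => α p.1 p.2) := fun {α} h =>
    (((prog_iff F α).1 h).mono (progSigma_le F)).measurable
  have hmem : ∀ {α : ℝ → Ω → ℝ}, ProgMeasurable F α → SqInt T P α →
      MemLp (fun p : ℝ × Ω => α p.1 p.2) 2 ((mI T).prod P) := fun {α} h h' =>
    (memLp_two_iff_integrable_sq (hmeas h).aestronglyMeasurable).2 h'
  let K := lpMeas ℝ ℝ (progSigma F) 2 ((mI T).prod P)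
  have : Fact (progSigma F ≤ Prod.instMeasurableSpace) := ⟨progSigma_le F⟩
  have : Fact ((1 : ENNReal) ≤ 2) := ⟨by norm_num⟩
  have hK : ∀ {α : ℝ → Ω → ℝ} (h : ProgMeasurable F α) (h' : SqInt T P α),
      (hmem h h').toLp _ ∈ K := by
    intro α h h'
    refine mem_lpMeas_iff_aestronglyMeasurable.2 ?_
    exact ⟨_, (prog_iff F α).1 h, (hmem h h').coeFn_toLp⟩
  have hbL := fun i => hmem (hb i).1 (hb i).2
  have hbsL := hmem hbstar.1 hbstar.2
  obtain ⟨a, haK, hopt, huniq⟩ := abstract_game K (DK P hA.1) (DK P hBk.1) (DK P hCk.1) lam w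
    hwdiag hwsymm (fun i => (hbL i).toLp _) (hbsL.toLp _) (fun i => ∫ ω, c i ω ∂P) c₀ hc₀
    (coerc_abs hA.1 hBk.1 hcoerc)
  have hrep : ∀ x ∈ K, ∃ α : ℝ → Ω → ℝ, Admissible T F P α ∧
      (x : ℝ × Ω → ℝ) =ᵐ[(mI T).prod P] fun p => α p.1 p.2 := by
    intro x hx
    obtain ⟨g, hg, hxg⟩ := mem_lpMeas_iff_aestronglyMeasurable.1 hx
    refine ⟨fun t ω => g (t, ω), ⟨(prog_iff F _).2 hg, ?_⟩, hxg⟩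
    exact ((Lp.memLp x).ae_eq hxg).integrable_sq
  -- translation of the Nash property
  have htrans : ∀ (α : Fin N → ℝ → Ω → ℝ) (hα : ∀ i, Admissible T F P (α i)),
      IsNashGraph T F P Atil Btil Ctil lam w b bstar c α ↔
      ∀ i, ∀ x ∈ K, Jabs (DK P hA.1) (DK P hBk.1) (DK P hCk.1) lam w
        (fun i => (hbL i).toLp _) (hbsL.toLp _) (fun i => ∫ ω, c i ω ∂P) i
        (Function.update (fun i => (hmem (hα i).1 (hα i).2).toLp _) i x) ≤
        Jabs (DK P hA.1) (DK P hBk.1) (DK P hCk.1) lam w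
        (fun i => (hbL i).toLp _) (hbsL.toLp _) (fun i => ∫ ω, c i ω ∂P) i
        (fun i => (hmem (hα i).1 (hα i).2).toLp _) := by
    intro α hα
    have hJ : ∀ (γ : Fin N → ℝ → Ω → ℝ) (hγ : ∀ i, Admissible T F P (γ i)) (i : Fin N),
        Jgraph T P Atil Btil Ctil lam w b bstar c i γ =
        Jabs (DK P hA.1) (DK P hBk.1) (DK P hCk.1) lam w
        (fun i => (hbL i).toLp _) (hbsL.toLp _) (fun i => ∫ ω, c i ω ∂P) i
        (fun i => (hmem (hγ i).1 (hγ i).2).toLp _) := fun γ hγ i =>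
      Jgraph_eq hA.1 hBk.1 hCk.1 lam w b bstar c hbL hbsL (fun i => (hc i).1) γ
        (fun i => hmeas (hγ i).1) (fun i => hmem (hγ i).1 (hγ i).2) i
    have hadm : ∀ (i : Fin N) (β : ℝ → Ω → ℝ), Admissible T F P β →
        ∀ j, Admissible T F P (Function.update α i β j) := by
      intro i β hβ j
      by_cases hj : j = i
      · subst hj; simpa using hβ
      · simpa [Function.update_of_ne hj] using hα j
    have aux1 : ∀ (j : Fin N) (u : Fin N → Lp ℝ 2 ((mI T).prod P)) (x : Lp ℝ 2 ((mI T).prod P)),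
        Function.update u j x j = x := fun j u x => Function.update_self _ _ _
    have aux2 : ∀ (i j : Fin N) (_ : j ≠ i) (u : Fin N → Lp ℝ 2 ((mI T).prod P))
        (x : Lp ℝ 2 ((mI T).prod P)), Function.update u i x j = u j :=
      fun i j hj u x => Function.update_of_ne hj _ _
    have hupd : ∀ (i : Fin N) (β : ℝ → Ω → ℝ) (hβ : Admissible T F P β),
        (fun j => (hmem (hadm i β hβ j).1 (hadm i β hβ j).2).toLp
          (fun p : ℝ × Ω => Function.update α i β j p.1 p.2)) =
        Function.update (fun i => (hmem (hα i).1 (hα i).2).toLp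
          (fun p : ℝ × Ω => α i p.1 p.2)) i
          ((hmem hβ.1 hβ.2).toLp (fun p : ℝ × Ω => β p.1 p.2)) := by
      intro i β hβ
      funext j
      by_cases hj : j = i
      · subst hj
        refine Eq.trans ?_ (aux1 j _ _).symm
        refine (MemLp.toLp_eq_toLp_iff _ _).2 (ae_of_all _ fun p => ?_)
        simp
      · refine Eq.trans ?_ (aux2 i j hj _ _).symm
        refine (MemLp.toLp_eq_toLp_iff _ _).2 (ae_of_all _ fun p => ?_)
        simp [Function.update_of_ne hj]
    constructor
    · intro h i x hx
      obtain ⟨β, hβ, hxβ⟩ := hrep x hx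
      have hx' : x = (hmem hβ.1 hβ.2).toLp (fun p : ℝ × Ω => β p.1 p.2) :=
        Lp.ext (hxβ.trans (hmem hβ.1 hβ.2).coeFn_toLp.symm)
      have h1 := h.2 i β hβ
      rw [hJ _ (hadm i β hβ), hJ α hα, hupd i β hβ, ← hx'] at h1
      exact h1
    · intro h
      refine ⟨hα, fun i β hβ => ?_⟩
      rw [hJ _ (hadm i β hβ), hJ α hα, hupd i β hβ]
      exact h i _ (hK hβ.1 hβ.2)
  choose αhat hadm hae using fun i => hrep (a i) (haK i)
  have hato : (fun i => (hmem (hadm i).1 (hadm i).2).toLp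
      (fun p : ℝ × Ω => αhat i p.1 p.2)) = a := by
    funext i
    exact (Lp.ext ((hae i).trans (hmem (hadm i).1 (hadm i).2).coeFn_toLp.symm)).symm
  refine ⟨αhat, (htrans αhat hadm).2 ?_, ?_⟩
  · rw [hato]; exact hopt
  · intro βhat hβ i
    have h1 := huniq _ (fun i => hK (hβ.1 i).1 (hβ.1 i).2) ((htrans βhat hβ.1).1 hβ)
    have h2 := congrFun h1 i
    have h3 := (hmem (hβ.1 i).1 (hβ.1 i).2).coeFn_toLp
    rw [← h2] at h3
    exact (hae i).symm.trans h3
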